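/- arXiv:cs/0607071 — 4 statements merged into one kernel-verified Lean document; each statement's English description precedes it below -/
import Mathlib

section
/- Every nonempty clause in standard form is an island: for any two states s₀ and sₙ that both satisfy the clause c, there exists a finite sequence of states s₀, s₁, …, sₙ such that every state in the sequence satisfies c and each consecutive pair of states differs in the value of exactly one variable. -/
/-- A state assigns a Boolean value to every variable. -/
abbrev State (V : Type*) := V → Bool

/-- A clause is a finite set of literals, each a pair of a variable and a polarity.
A state satisfies a clause if at least one of its literals is true in the state. -/
def Sat {V : Type*} (s : State V) (c : Finset (V × Bool)) : Prop :=
  ∃ l ∈ c, s l.1 = l.2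

/-- A clause is in standard form if no variable occurs in it with both polarities. -/
def StdForm {V : Type*} (c : Finset (V × Bool)) : Prop :=
  ¬ ∃ x : V, (x, true) ∈ c ∧ (x, false) ∈ c

/-- Two states are neighbours if they differ in the value of exactly one variable. -/
def Neighbour {V : Type*} (s s' : State V) : Prop :=
  ∃! x : V, s x ≠ s' x

/-- A set `C` of clauses is an island if any two states satisfying every clause of `C`
are connected by a finite sequence of states, each satisfying every clause of `C`,
in which consecutive states are neighbours. -/
def IsIsland {V : Type*} (C : Set (Finset (V × Bool))) : Prop :=
  ∀ s₀ sN : State V, (∀ c ∈ C, Sat s₀ c) → (∀ c ∈ C, Sat sN c) →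
    ∃ (n : ℕ) (p : Fin (n + 1) → State V),
      p 0 = s₀ ∧ p (Fin.last n) = sN ∧
      (∀ i, ∀ c ∈ C, Sat (p i) c) ∧
      ∀ i : Fin n, Neighbour (p i.castSucc) (p i.succ)

/-- Points related by the reflexive transitive closure are joined by a finite path. -/
theorem exists_path_of_reflTransGen {α : Type*} {r : α → α → Prop} {a b : α}
    (h : Relation.ReflTransGen r a b) :
    ∃ (n : ℕ) (p : Fin (n + 1) → α), p 0 = a ∧ p (Fin.last n) = b ∧
      ∀ i : Fin n, r (p i.castSucc) (p i.succ) := by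
  induction h using Relation.ReflTransGen.head_induction_on with
  | refl => exact ⟨0, fun _ => b, rfl, rfl, fun i => i.elim0⟩
  | @head a c hac _ ih =>
    obtain ⟨n, p, hp0, hpn, hp⟩ := ih
    refine ⟨n + 1, Fin.cons a p, rfl, ?_, fun i => ?_⟩
    · rw [← Fin.succ_last, Fin.cons_succ, hpn]
    · refine Fin.cases ?_ (fun j => ?_) i
      · simpa [hp0] using hac
      · rw [← Fin.succ_castSucc, Fin.cons_succ, Fin.cons_succ]
        exact hp j

/-- Overwriting one variable with a different value gives a neighbour. -/
theorem neighbour_update {V : Type*} [DecidableEq V] {s : State V} {x : V} {b : Bool}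
    (h : s x ≠ b) : Neighbour s (Function.update s x b) := by
  refine ⟨x, by simpa using h, fun y hy => ?_⟩
  by_contra hyx
  exact hy (by simp [Function.update_of_ne hyx])

/-- Two states making the same literal of a clause true are connected through neighbouring
states satisfying the clause. -/
theorem reflTransGen_neighbour_of_common_literal {V : Type*} [DecidableEq V] [Fintype V]
    {c : Finset (V × Bool)} {l : V × Bool} (hl : l ∈ c) {t : State V} (ht : t l.1 = l.2)
    (s : State V) (hs : s l.1 = l.2) :
    Relation.ReflTransGen (fun u v => Sat v c ∧ Neighbour u v) s t := by
  induction hn : (Finset.univ.filter fun x => s x ≠ t x).card using Nat.strong_induction_on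
    generalizing s with
  | _ n ih =>
    by_cases hst : s = t
    · exact hst ▸ .refl
    obtain ⟨x, hx⟩ := Function.ne_iff.mp hst
    have hs' : Function.update s x (t x) l.1 = l.2 := by
      by_cases hlx : l.1 = x
      · rw [← hlx, Function.update_self, ht]
      · rw [Function.update_of_ne hlx, hs]
    refine .head ⟨⟨l, hl, hs'⟩, neighbour_update hx⟩ (ih _ ?_ _ hs' rfl)
    rw [← hn]
    refine Finset.card_lt_card (Finset.ssubset_iff_of_subset ?_ |>.mpr ⟨x, ?_, ?_⟩)
    · intro y hy
      by_cases hyx : y = x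
      · simpa [hyx] using hx
      · simpa [Function.update_of_ne hyx] using hy
    · simpa using hx
    · simp

/-- Every nonempty clause in standard form is an island. -/
theorem clause_isIsland {V : Type*} [DecidableEq V] [Fintype V]
    (c : Finset (V × Bool)) (hne : c.Nonempty) (hstd : StdForm c) :
    IsIsland {c} := by
  intro s t hs ht
  obtain ⟨l, hl, hsl⟩ := hs c rfl
  obtain ⟨m, hm, htm⟩ := ht c rfl
  have key : Relation.ReflTransGen (fun u v => Sat v c ∧ Neighbour u v) s t := by
    by_cases hlm : l.1 = m.1
    · have hpol : l.2 = m.2 := by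
        obtain ⟨x, b⟩ := l
        obtain ⟨y, d⟩ := m
        obtain rfl : x = y := hlm
        cases b <;> cases d <;> first | rfl | exact absurd ⟨x, by assumption, by assumption⟩ hstd
      exact reflTransGen_neighbour_of_common_literal hl (by rw [hlm, hpol, htm]) s hsl
    · exact (reflTransGen_neighbour_of_common_literal hl
          (t := Function.update t l.1 l.2) (by simp) s hsl).trans
        (reflTransGen_neighbour_of_common_literal hm htm _
          (by rw [Function.update_of_ne (Ne.symm hlm), htm]))
  obtain ⟨n, p, hp0, hpn, hp⟩ := exists_path_of_reflTransGen key
  refine ⟨n, p, hp0, hpn, fun i d hd => ?_, fun i => (hp i).2⟩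
  obtain rfl : d = c := hd
  refine Fin.cases ?_ (fun j => (hp j).1) i
  rw [hp0]
  exact ⟨l, hl, hsl⟩
end

section
/- Every non-conflicting finite set C of nonempty standard-form clauses forms an island: for any two states that each satisfy all clauses in C, there is a finite sequence of states, each satisfying all clauses in C, connecting them, in which consecutive states differ in the value of exactly one variable. -/
/-- A set of clauses is non-conflicting if no variable occurs with both polarities
among the literals of its clauses. -/
def NonConflicting {V : Type*} (C : Set (Finset (V × Bool))) : Prop :=
  ¬ ∃ x : V, (∃ c ∈ C, (x, true) ∈ c) ∧ (∃ c ∈ C, (x, false) ∈ c)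

theorem Neighbour.symm {V : Type*} {s s' : State V} (h : Neighbour s s') : Neighbour s' s := by
  simpa only [Neighbour, ne_comm] using h

/-- Points related by the reflexive transitive closure of `r` are joined by a finite
sequence with consecutive terms related by `r`. -/
theorem Relation.ReflTransGen.exists_sequence {α : Type*} {r : α → α → Prop} {a b : α}
    (h : Relation.ReflTransGen r a b) :
    ∃ (n : ℕ) (p : ℕ → α), p 0 = a ∧ p n = b ∧ ∀ i < n, r (p i) (p (i + 1)) := by
  induction h using Relation.ReflTransGen.head_induction_on with
  | refl => exact ⟨0, fun _ => b, rfl, rfl, by simp⟩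
  | @head a c hac _ ih =>
    obtain ⟨n, p, h0, hn, hp⟩ := ih
    refine ⟨n + 1, fun k => Nat.casesOn k a p, rfl, hn, fun i hi => ?_⟩
    cases i with
    | zero => simpa [h0] using hac
    | succ i => exact hp i (by omega)

/-- A non-conflicting set of clauses has a state making all occurring literals true. -/
theorem NonConflicting.exists_forall_literal_true {V : Type*} {C : Set (Finset (V × Bool))}
    (h : NonConflicting C) : ∃ t : State V, ∀ c ∈ C, ∀ l ∈ c, t l.1 = l.2 := by
  classical
  refine ⟨fun x => decide (∃ c ∈ C, (x, true) ∈ c), ?_⟩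
  rintro c hc ⟨x, b⟩ hl
  cases b with
  | true => exact decide_eq_true ⟨c, hc, hl⟩
  | false => exact decide_eq_false fun hx => h ⟨x, hx, c, hc, hl⟩

/-- If `t` makes all literals of `C` true, any state satisfying `C` is joined to `t`
by neighbour steps between states satisfying `C`. -/
theorem reflTransGen_of_forall_literal_true {V : Type*} [DecidableEq V] [Fintype V]
    {C : Set (Finset (V × Bool))} {s t : State V} (ht : ∀ c ∈ C, ∀ l ∈ c, t l.1 = l.2)
    (hs : ∀ c ∈ C, Sat s c) :
    Relation.ReflTransGen
      (fun u v => (∀ c ∈ C, Sat u c) ∧ (∀ c ∈ C, Sat v c) ∧ Neighbour u v) s t := by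
  have sat_piecewise (A : Finset V) : ∀ c ∈ C, Sat (A.piecewise t s) c := fun c hc => by
    obtain ⟨l, hl, hsl⟩ := hs c hc
    refine ⟨l, hl, ?_⟩
    by_cases hA : l.1 ∈ A
    · simpa [hA] using ht c hc l hl
    · simpa [hA] using hsl
  suffices H : ∀ A : Finset V, Relation.ReflTransGen
      (fun u v => (∀ c ∈ C, Sat u c) ∧ (∀ c ∈ C, Sat v c) ∧ Neighbour u v)
      s (A.piecewise t s) by
    simpa using H Finset.univ
  intro A
  induction A using Finset.induction_on with
  | empty => simpa using Relation.ReflTransGen.refl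
  | insert x A _ ih =>
    by_cases hx : A.piecewise t s x = t x
    · rwa [Finset.piecewise_insert, ← hx, Function.update_eq_self]
    · refine ih.tail ⟨sat_piecewise A, sat_piecewise (insert x A), ?_⟩
      rw [Finset.piecewise_insert]
      exact neighbour_update hx

/-- Every non-conflicting finite set of nonempty standard-form clauses forms an island. -/
theorem nonConflicting_isIsland {V : Type*} [DecidableEq V] [Fintype V]
    (C : Finset (Finset (V × Bool)))
    (hne : ∀ c ∈ C, Finset.Nonempty c) (hstd : ∀ c ∈ C, StdForm c)
    (hnc : NonConflicting (↑C : Set (Finset (V × Bool)))) :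
    IsIsland (↑C : Set (Finset (V × Bool))) := by
  intro s₀ sN h₀ hN
  obtain ⟨t, ht⟩ := hnc.exists_forall_literal_true
  have : Std.Symm fun u v : State V =>
      (∀ c ∈ (C : Set (Finset (V × Bool))), Sat u c) ∧
        (∀ c ∈ (C : Set (Finset (V × Bool))), Sat v c) ∧ Neighbour u v :=
    ⟨fun _ _ h => ⟨h.2.1, h.1, h.2.2.symm⟩⟩
  have hback := Relation.ReflTransGen.stdSymm.symm _ _ (reflTransGen_of_forall_literal_true ht hN)
  obtain ⟨n, p, hp0, hpn, hp⟩ :=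
    ((reflTransGen_of_forall_literal_true ht h₀).trans hback).exists_sequence
  refine ⟨n, fun i => p i, hp0, hpn, fun i => ?_, fun i => (hp i i.2).2.2⟩
  rcases (Nat.lt_succ_iff.mp i.2).lt_or_eq with hi | hi
  · exact (hp i hi).1
  · simpa only [hi, hpn] using hN
end

section
/- Let < be a linear order on the variables, C a finite set of nonempty standard-form clauses that is <-primal non-conflicting, and let s be a state satisfying all clauses of C in which some literal of pLit_<(C) is false. Let x be the <-least variable among those variables whose literal in pLit_<(C) is false in s, and let s' be the state obtained from s by flipping the value of x. Then s' satisfies all clauses of C. -/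
/-- `l` is the `<`-primal literal of clause `c`: it belongs to `c` and its variable is
least (w.r.t. the order) among the variables occurring in `c`. -/
def PrimalLit {V : Type*} [LinearOrder V] (c : Finset (V × Bool)) (l : V × Bool) : Prop :=
  l ∈ c ∧ ∀ l' ∈ c, l.1 ≤ l'.1

/-- The `<`-primal literal set of a set of clauses. -/
def PLit {V : Type*} [LinearOrder V] (C : Set (Finset (V × Bool))) : Set (V × Bool) :=
  {l | ∃ c ∈ C, PrimalLit c l}

/-- `C` is `<`-primal non-conflicting if no variable occurs with both polarities
in the `<`-primal literal set of `C`. -/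
def PrimalNonConflicting {V : Type*} [LinearOrder V] (C : Set (Finset (V × Bool))) : Prop :=
  ¬ ∃ x : V, (x, true) ∈ PLit C ∧ (x, false) ∈ PLit C

/-- Let `C` be a `<`-primal non-conflicting finite set of nonempty standard-form
clauses, `s` a state satisfying all clauses of `C`, and `x` the `<`-least variable
among those whose literal in the `<`-primal literal set of `C` is false in `s`.
Then the state obtained from `s` by flipping the value of `x` still satisfies
all clauses of `C`. -/
theorem flip_least_false_primal_var {V : Type*} [LinearOrder V]
    (C : Finset (Finset (V × Bool)))
    (hne : ∀ c ∈ C, Finset.Nonempty c) (hstd : ∀ c ∈ C, StdForm c)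
    (hpnc : PrimalNonConflicting (↑C : Set (Finset (V × Bool))))
    (s : State V) (hs : ∀ c ∈ C, Sat s c)
    (x : V)
    (hx : ∃ b : Bool, (x, b) ∈ PLit (↑C : Set (Finset (V × Bool))) ∧ s x ≠ b)
    (hleast : ∀ y : V,
      (∃ b : Bool, (y, b) ∈ PLit (↑C : Set (Finset (V × Bool))) ∧ s y ≠ b) → x ≤ y) :
    ∀ c ∈ C, Sat (Function.update s x (!(s x))) c := by
  obtain ⟨b, hb, hsb⟩ := hx
  intro c hc
  obtain ⟨⟨y, a⟩, hmem, hmin⟩ := c.exists_min_image Prod.fst (hne c hc)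
  have hP : (y, a) ∈ PLit (↑C : Set (Finset (V × Bool))) := ⟨c, hc, hmem, hmin⟩
  by_cases hyx : y = x
  · subst hyx
    have hab : a = b := by
      by_contra hab
      apply hpnc
      cases a <;> cases b <;> first | exact absurd rfl hab | exact ⟨y, ‹_›, ‹_›⟩
    refine ⟨(y, a), hmem, ?_⟩
    simpa [hab, Bool.eq_not] using hsb
  · by_cases hsy : s y = a
    · exact ⟨(y, a), hmem, by simpa [Function.update_of_ne hyx] using hsy⟩
    · have hxy : x < y := lt_of_le_of_ne (hleast y ⟨a, hP, hsy⟩) (Ne.symm hyx)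
      obtain ⟨l, hl, hsl⟩ := hs c hc
      exact ⟨l, hl, by rw [Function.update_of_ne (hxy.trans_le (hmin l hl)).ne', hsl]⟩
end

section
/- Let < be a linear order on the variables and C a finite set of nonempty standard-form clauses that is <-primal non-conflicting. Then any two states ŝ and ŝ' in which every literal of pLit_<(C) is true are connected within the solution space of C: there is a finite sequence of states from ŝ to ŝ', each making every literal of pLit_<(C) true (hence each satisfying all clauses of C), in which consecutive states differ in the value of exactly one variable not occurring in pLit_<(C). -/
/-- Two states on finitely many variables are joined by flipping, one at a time,
the variables on which they differ. -/
theorem exists_flip_path {V : Type*} [DecidableEq V] [Fintype V] (t : State V) (n : ℕ) :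
    ∀ s : State V, (Finset.univ.filter fun x => s x ≠ t x).card = n →
      ∃ p : Fin (n + 1) → State V, p 0 = s ∧ p (Fin.last n) = t ∧
        (∀ i x, s x = t x → p i x = t x) ∧
        ∀ i : Fin n, ∃ x : V, s x ≠ t x ∧ p i.castSucc x ≠ p i.succ x ∧
          ∀ y : V, p i.castSucc y ≠ p i.succ y → y = x := by
  induction n with
  | zero =>
    intro s hs
    have hst : s = t := by
      funext x
      simpa using Finset.filter_eq_empty_iff.mp (Finset.card_eq_zero.mp hs) (Finset.mem_univ x)
    exact ⟨fun _ => s, rfl, hst, fun _ _ hx => hx, fun i => i.elim0⟩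
  | succ n ih =>
    intro s hs
    obtain ⟨x, hx⟩ := Finset.card_pos.mp (n.succ_pos.trans_eq hs.symm)
    have hxt : s x ≠ t x := (Finset.mem_filter.mp hx).2
    have hcard : (Finset.univ.filter fun y => Function.update s x (t x) y ≠ t y).card = n := by
      have : (Finset.univ.filter fun y => Function.update s x (t x) y ≠ t y) =
          (Finset.univ.filter fun y => s y ≠ t y).erase x := by
        ext y
        by_cases hy : y = x
        · subst hy; simp
        · simp [hy]
      rw [this, Finset.card_erase_of_mem hx, hs, Nat.add_sub_cancel]
    have hne {y : V} (hy : Function.update s x (t x) y ≠ t y) : s y ≠ t y := by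
      by_cases hyx : y = x
      · rwa [hyx]
      · rwa [Function.update_of_ne hyx] at hy
    obtain ⟨p, hp0, hpl, hpa, hps⟩ := ih _ hcard
    refine ⟨Fin.cons s p, rfl, ?_, fun i => ?_, fun i => ?_⟩
    · rw [← Fin.succ_last, Fin.cons_succ, hpl]
    · refine Fin.cases (fun _ hy => hy) (fun j y hy => ?_) i
      exact hpa j y (not_not.mp fun hy' => hne hy' hy)
    · refine Fin.cases ?_ (fun j => ?_) i
      · refine ⟨x, hxt, by simpa [hp0] using hxt, fun y hy => ?_⟩
        by_contra hyx
        simp [hp0, hyx] at hy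
      · obtain ⟨y, hy, hj⟩ := hps j
        exact ⟨y, hne hy, by simpa only [← Fin.succ_castSucc, Fin.cons_succ] using hj⟩

/-- A state making every primal literal true satisfies every nonempty clause. -/
theorem sat_of_pLit {V : Type*} [LinearOrder V] {C : Set (Finset (V × Bool))}
    {s : State V} (hs : ∀ l ∈ PLit C, s l.1 = l.2) {c : Finset (V × Bool)}
    (hc : c ∈ C) (hne : c.Nonempty) : Sat s c := by
  obtain ⟨l, hl, hmin⟩ := c.exists_min_image Prod.fst hne
  exact ⟨l, hl, hs l ⟨c, hc, hl, hmin⟩⟩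

/-- Let `C` be a `<`-primal non-conflicting finite set of nonempty standard-form
clauses.  Any two states making every literal of the `<`-primal literal set of `C`
true are connected by a finite sequence of states, each making every literal of the
`<`-primal literal set true (hence each satisfying all clauses of `C`), in which
consecutive states differ in the value of exactly one variable not occurring in the
`<`-primal literal set. -/
theorem pLit_states_connected {V : Type*} [LinearOrder V] [Fintype V]
    (C : Finset (Finset (V × Bool)))
    (hne : ∀ c ∈ C, Finset.Nonempty c) (hstd : ∀ c ∈ C, StdForm c)
    (hpnc : PrimalNonConflicting (↑C : Set (Finset (V × Bool))))
    (sHat sHat' : State V)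
    (h : ∀ l ∈ PLit (↑C : Set (Finset (V × Bool))), sHat l.1 = l.2)
    (h' : ∀ l ∈ PLit (↑C : Set (Finset (V × Bool))), sHat' l.1 = l.2) :
    ∃ (n : ℕ) (p : Fin (n + 1) → State V),
      p 0 = sHat ∧ p (Fin.last n) = sHat' ∧
      (∀ i, ∀ l ∈ PLit (↑C : Set (Finset (V × Bool))), (p i) l.1 = l.2) ∧
      (∀ i, ∀ c ∈ C, Sat (p i) c) ∧
      ∀ i : Fin n, ∃ x : V,
        (∀ l ∈ PLit (↑C : Set (Finset (V × Bool))), l.1 ≠ x) ∧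
        p i.castSucc x ≠ p i.succ x ∧
        ∀ y : V, p i.castSucc y ≠ p i.succ y → y = x := by
  obtain ⟨p, hp0, hpl, hpa, hps⟩ := exists_flip_path sHat' _ sHat rfl
  have hp : ∀ i, ∀ l ∈ PLit (↑C : Set (Finset (V × Bool))), (p i) l.1 = l.2 :=
    fun i l hl => (hpa i l.1 ((h l hl).trans (h' l hl).symm)).trans (h' l hl)
  refine ⟨_, p, hp0, hpl, hp, fun i c hc => sat_of_pLit (hp i) hc (hne c hc), fun i => ?_⟩
  obtain ⟨x, hx, hi⟩ := hps i
  refine ⟨x, fun l hl hlx => hx ?_, hi⟩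
  rw [← hlx, h l hl, h' l hl]
end
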